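/- For any finite simplicial complex K, the total complex of the reduced double complex Ñ^{*,*}(K) (generated by σ⊗τ with σ ⊆ τ, including the empty simplex, with differential Δ(σ⊗τ) = dσ⊗τ + (-1)^{|σ|} σ⊗δτ) has cohomology isomorphic to ℤ concentrated in total degree 0. -/

import Mathlib

open Finset

/-- A finite abstract simplicial complex with vertices in `ℕ`. -/
structure SC where
  faces : Finset (Finset ℕ)
  down_closed : ∀ ⦃s t : Finset ℕ⦄, s ∈ faces → t ⊆ s → t ∈ faces

namespace SC

/-- The vertex set of a simplicial complex. -/
def verts (K : SC) : Finset ℕ := K.faces.sup id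

/-- The dimension of a simplicial complex (dimension of `{∅}` is `-1`). -/
def dim (K : SC) : ℤ := ((K.faces.sup Finset.card : ℕ) : ℤ) - 1

/-- The link of a simplex. -/
def link (K : SC) (σ : Finset ℕ) : SC where
  faces := K.faces.filter fun t => σ ∪ t ∈ K.faces ∧ Disjoint σ t
  down_closed := by
    intro s t hs hts
    simp only [mem_filter] at hs ⊢
    refine ⟨K.down_closed hs.1 hts, K.down_closed hs.2.1 (union_subset_union_right hts),
      hs.2.2.mono_right ?_⟩
    exact_mod_cast hts

/-- `K₁` is a subcomplex of `K`. -/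
def IsSub (K₁ K : SC) : Prop := K₁.faces ⊆ K.faces

/-- Union of two simplicial complexes. -/
def union (K L : SC) : SC where
  faces := K.faces ∪ L.faces
  down_closed := by
    intro s t hs hts
    rcases mem_union.mp hs with h | h
    · exact mem_union_left _ (K.down_closed h hts)
    · exact mem_union_right _ (L.down_closed h hts)

/-- Intersection of two simplicial complexes. -/
def inter (K L : SC) : SC where
  faces := K.faces ∩ L.faces
  down_closed := by
    intro s t hs hts
    rw [mem_inter] at hs ⊢
    exact ⟨K.down_closed hs.1 hts, L.down_closed hs.2 hts⟩

/-- The join of two simplicial complexes. -/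
def join (K L : SC) : SC where
  faces := (K.faces ×ˢ L.faces).image fun x => x.1 ∪ x.2
  down_closed := by
    intro s t hs hts
    simp only [mem_image, mem_product] at hs ⊢
    obtain ⟨⟨a, b⟩, ⟨ha, hb⟩, rfl⟩ := hs
    refine ⟨⟨t ∩ a, t \ a⟩, ⟨K.down_closed ha inter_subset_right,
      L.down_closed hb fun x hx => ?_⟩, ?_⟩
    · rcases mem_union.mp (hts (mem_sdiff.mp hx).1) with h | h
      · exact absurd h (mem_sdiff.mp hx).2
      · exact h
    · ext x
      simp only [mem_union, mem_inter, mem_sdiff]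
      constructor
      · rintro (⟨h, _⟩ | ⟨h, _⟩) <;> exact h
      · intro hx
        by_cases hxa : x ∈ a
        · exact Or.inl ⟨hx, hxa⟩
        · exact Or.inr ⟨hx, hxa⟩

end SC
namespace SC
open Finset

/-- The sign of a vertex `v` in a simplex, given by its position in the canonical ordering. -/
def psgn (v : ℕ) (s : Finset ℕ) : ℤ := (-1) ^ (s.filter fun u => u < v).card

variable (G : Type) [AddCommGroup G]

/-- The submodule of functions supported on a given set of indices. -/
def suppM {α : Type} (P : α → Prop) : Submodule ℤ (α → G) where
  carrier := {c | ∀ x, c x ≠ 0 → P x}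
  add_mem' := by
    intro a b ha hb x hx
    by_cases h : a x = 0
    · exact hb x (by simpa [h] using hx)
    · exact ha x h
  zero_mem' := fun x hx => absurd rfl hx
  smul_mem' := by
    intro z a ha x hx
    exact ha x fun h => hx (by simp [h])

end SC
namespace SC
open Finset

variable (G : Type) [AddCommGroup G]

/-- The unreduced simplicial coboundary (as a map on coefficient functions). -/
def cobF (K : SC) (c : Finset ℕ → G) : Finset ℕ → G := fun ρ =>
  if ρ ∈ K.faces then
    ∑ w ∈ ρ, if ρ.erase w = ∅ then 0 else psgn w ρ • c (ρ.erase w)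
  else 0

/-- The reduced simplicial coboundary. -/
def cobRF (K : SC) (c : Finset ℕ → G) : Finset ℕ → G := fun ρ =>
  if ρ ∈ K.faces then ∑ w ∈ ρ, psgn w ρ • c (ρ.erase w) else 0

/-- The unreduced simplicial coboundary as a linear map. -/
def cobL (K : SC) : (Finset ℕ → G) →ₗ[ℤ] (Finset ℕ → G) where
  toFun := cobF G K
  map_add' := by
    intro a b
    funext ρ
    simp only [cobF, Pi.add_apply]
    split_ifs with h
    · rw [← Finset.sum_add_distrib]
      refine Finset.sum_congr rfl fun w _ => ?_
      split_ifs with h2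
      · simp
      · simp [smul_add]
    · simp
  map_smul' := by
    intro z a
    funext ρ
    simp only [cobF, Pi.smul_apply, RingHom.id_apply]
    split_ifs with h
    · rw [Finset.smul_sum]
      refine Finset.sum_congr rfl fun w _ => ?_
      split_ifs with h2
      · simp
      · rw [smul_smul, smul_smul, mul_comm]
    · simp

/-- The reduced simplicial coboundary as a linear map. -/
def cobRL (K : SC) : (Finset ℕ → G) →ₗ[ℤ] (Finset ℕ → G) where
  toFun := cobRF G K
  map_add' := by
    intro a b
    funext ρ
    simp only [cobRF, Pi.add_apply]
    split_ifs with h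
    · rw [← Finset.sum_add_distrib]
      exact Finset.sum_congr rfl fun w _ => smul_add _ _ _
    · simp
  map_smul' := by
    intro z a
    funext ρ
    simp only [cobRF, Pi.smul_apply, RingHom.id_apply]
    split_ifs with h
    · rw [Finset.smul_sum]
      refine Finset.sum_congr rfl fun w _ => ?_
      rw [smul_smul, smul_smul, mul_comm]
    · simp

/-- Degree-`q` unreduced simplicial cochains of `K` with coefficients in `G`. -/
def Cgr (K : SC) (q : ℤ) : Submodule ℤ (Finset ℕ → G) :=
  suppM G fun s => s ∈ K.faces ∧ s ≠ ∅ ∧ (s.card : ℤ) = q + 1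

/-- Degree-`q` reduced simplicial cochains (the empty simplex sits in degree `-1`). -/
def CgrR (K : SC) (q : ℤ) : Submodule ℤ (Finset ℕ → G) :=
  suppM G fun s => s ∈ K.faces ∧ (s.card : ℤ) = q + 1

/-- The degree-`q` simplicial cohomology of `K` with coefficients in `G`. -/
abbrev coh (K : SC) (q : ℤ) :=
  ↥(Cgr G K q ⊓ LinearMap.ker (cobL G K)) ⧸
    Submodule.comap (Cgr G K q ⊓ LinearMap.ker (cobL G K)).subtype
      (Submodule.map (cobL G K) (Cgr G K (q - 1)))

/-- The degree-`q` reduced simplicial cohomology of `K` with coefficients in `G`. -/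
abbrev cohR (K : SC) (q : ℤ) :=
  ↥(CgrR G K q ⊓ LinearMap.ker (cobRL G K)) ⧸
    Submodule.comap (CgrR G K q ⊓ LinearMap.ker (cobRL G K)).subtype
      (Submodule.map (cobRL G K) (CgrR G K (q - 1)))

end SC
namespace SC
open Finset

/-- Pairs of simplices, indexing the double complex `N^{*,*}`. -/
abbrev Pr := Finset ℕ × Finset ℕ

variable (G : Type) [AddCommGroup G]

/-- The `(p,q)`-graded piece of the double complex `N^{*,*}(K)` spanned by `σ ⊗ τ`, `σ ⊆ τ`. -/
def Ngr (K : SC) (p q : ℤ) : Submodule ℤ (Pr → G) :=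
  suppM G fun x => x.1 ⊆ x.2 ∧ x.2 ∈ K.faces ∧ x.1 ≠ ∅ ∧
    (x.1.card : ℤ) = p + 1 ∧ (x.2.card : ℤ) = q + 1

/-- The `(p,q)`-graded piece of the reduced double complex `Ñ^{*,*}(K)`. -/
def NgrR (K : SC) (p q : ℤ) : Submodule ℤ (Pr → G) :=
  suppM G fun x => x.1 ⊆ x.2 ∧ x.2 ∈ K.faces ∧
    (x.1.card : ℤ) = p + 1 ∧ (x.2.card : ℤ) = q + 1

/-- The vertical differential `σ ⊗ τ ↦ (-1)^{|σ|} σ ⊗ δτ` (unreduced). -/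
def dvF (K : SC) (c : Pr → G) : Pr → G := fun x =>
  if x.2 ∈ K.faces ∧ x.1 ⊆ x.2 ∧ x.1 ≠ ∅ then
    ((-1 : ℤ) ^ x.1.card) •
      ∑ w ∈ x.2, if x.1 ⊆ x.2.erase w then psgn w x.2 • c (x.1, x.2.erase w) else 0
  else 0

/-- The horizontal differential `σ ⊗ τ ↦ dσ ⊗ τ` (unreduced). -/
def dhF (K : SC) (c : Pr → G) : Pr → G := fun x =>
  if x.2 ∈ K.faces ∧ x.1 ⊆ x.2 ∧ x.1 ≠ ∅ then
    ∑ v ∈ x.2 \ x.1, psgn v (insert v x.1) • c (insert v x.1, x.2)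
  else 0

/-- The vertical differential (reduced). -/
def dvRF (K : SC) (c : Pr → G) : Pr → G := fun x =>
  if x.2 ∈ K.faces ∧ x.1 ⊆ x.2 then
    ((-1 : ℤ) ^ x.1.card) •
      ∑ w ∈ x.2, if x.1 ⊆ x.2.erase w then psgn w x.2 • c (x.1, x.2.erase w) else 0
  else 0

/-- The horizontal differential (reduced). -/
def dhRF (K : SC) (c : Pr → G) : Pr → G := fun x =>
  if x.2 ∈ K.faces ∧ x.1 ⊆ x.2 then
    ∑ v ∈ x.2 \ x.1, psgn v (insert v x.1) • c (insert v x.1, x.2)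
  else 0

/-- The vertical differential as a linear map (unreduced). -/
def dvL (K : SC) : (Pr → G) →ₗ[ℤ] (Pr → G) where
  toFun := dvF G K
  map_add' := by
    intro a b
    funext x
    simp only [dvF, Pi.add_apply]
    split_ifs with h
    · rw [← smul_add, ← Finset.sum_add_distrib]
      congr 1
      refine Finset.sum_congr rfl fun w _ => ?_
      split_ifs with h2
      · simp [smul_add]
      · simp
    · simp
  map_smul' := by
    intro z a
    funext x
    simp only [dvF, Pi.smul_apply, RingHom.id_apply]
    split_ifs with h
    · rw [smul_comm z]
      congr 1
      rw [Finset.smul_sum]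
      refine Finset.sum_congr rfl fun w _ => ?_
      split_ifs with h2
      · rw [smul_smul, smul_smul, mul_comm]
      · simp
    · simp

/-- The horizontal differential as a linear map (unreduced). -/
def dhL (K : SC) : (Pr → G) →ₗ[ℤ] (Pr → G) where
  toFun := dhF G K
  map_add' := by
    intro a b
    funext x
    simp only [dhF, Pi.add_apply]
    split_ifs with h
    · rw [← Finset.sum_add_distrib]
      exact Finset.sum_congr rfl fun v _ => smul_add _ _ _
    · simp
  map_smul' := by
    intro z a
    funext x
    simp only [dhF, Pi.smul_apply, RingHom.id_apply]
    split_ifs with h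
    · rw [Finset.smul_sum]
      refine Finset.sum_congr rfl fun v _ => ?_
      rw [smul_smul, smul_smul, mul_comm]
    · simp

/-- The vertical differential as a linear map (reduced). -/
def dvRL (K : SC) : (Pr → G) →ₗ[ℤ] (Pr → G) where
  toFun := dvRF G K
  map_add' := by
    intro a b
    funext x
    simp only [dvRF, Pi.add_apply]
    split_ifs with h
    · rw [← smul_add, ← Finset.sum_add_distrib]
      congr 1
      refine Finset.sum_congr rfl fun w _ => ?_
      split_ifs with h2
      · simp [smul_add]
      · simp
    · simp
  map_smul' := by
    intro z a
    funext x
    simp only [dvRF, Pi.smul_apply, RingHom.id_apply]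
    split_ifs with h
    · rw [smul_comm z]
      congr 1
      rw [Finset.smul_sum]
      refine Finset.sum_congr rfl fun w _ => ?_
      split_ifs with h2
      · rw [smul_smul, smul_smul, mul_comm]
      · simp
    · simp

/-- The horizontal differential as a linear map (reduced). -/
def dhRL (K : SC) : (Pr → G) →ₗ[ℤ] (Pr → G) where
  toFun := dhRF G K
  map_add' := by
    intro a b
    funext x
    simp only [dhRF, Pi.add_apply]
    split_ifs with h
    · rw [← Finset.sum_add_distrib]
      exact Finset.sum_congr rfl fun v _ => smul_add _ _ _
    · simp
  map_smul' := by
    intro z a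
    funext x
    simp only [dhRF, Pi.smul_apply, RingHom.id_apply]
    split_ifs with h
    · rw [Finset.smul_sum]
      refine Finset.sum_congr rfl fun v _ => ?_
      rw [smul_smul, smul_smul, mul_comm]
    · simp

/-- The total differential `Δ(σ⊗τ) = dσ⊗τ + (-1)^{|σ|}σ⊗δτ` (unreduced). -/
def dL (K : SC) : (Pr → G) →ₗ[ℤ] (Pr → G) := dhL G K + dvL G K

/-- The total differential (reduced). -/
def dRL (K : SC) : (Pr → G) →ₗ[ℤ] (Pr → G) := dhRL G K + dvRL G K

/-- Cocycles for the `E₁`-page: `ker Δ_v` in bidegree `(p,q)`. -/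
def Z1 (K : SC) (p q : ℤ) : Submodule ℤ (Pr → G) :=
  Ngr G K p q ⊓ LinearMap.ker (dvL G K)

/-- Coboundaries for the `E₁`-page. -/
def B1 (K : SC) (p q : ℤ) : Submodule ℤ (Pr → G) :=
  Submodule.map (dvL G K) (Ngr G K p (q - 1)) ⊓ Ngr G K p q

/-- The `E₁`-page of the cohomeology spectral sequence in bidegree `(p,q)`. -/
abbrev E1 (K : SC) (p q : ℤ) :=
  ↥(Z1 G K p q) ⧸ Submodule.comap (Z1 G K p q).subtype (B1 G K p q)

/-- Reduced `E₁`-cocycles. -/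
def Z1R (K : SC) (p q : ℤ) : Submodule ℤ (Pr → G) :=
  NgrR G K p q ⊓ LinearMap.ker (dvRL G K)

/-- Reduced `E₁`-coboundaries. -/
def B1R (K : SC) (p q : ℤ) : Submodule ℤ (Pr → G) :=
  Submodule.map (dvRL G K) (NgrR G K p (q - 1)) ⊓ NgrR G K p q

/-- The `E₁`-page of the reduced cohomeology spectral sequence. -/
abbrev E1R (K : SC) (p q : ℤ) :=
  ↥(Z1R G K p q) ⧸ Submodule.comap (Z1R G K p q).subtype (B1R G K p q)

/-- `E₂`-cocycles: vertical cocycles whose horizontal differential is a vertical coboundary. -/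
def Z2 (K : SC) (p q : ℤ) : Submodule ℤ (Pr → G) :=
  Ngr G K p q ⊓ LinearMap.ker (dvL G K) ⊓
    Submodule.comap (dhL G K) (Submodule.map (dvL G K) (Ngr G K (p - 1) (q - 1)))

/-- `E₂`-coboundaries. -/
def B2 (K : SC) (p q : ℤ) : Submodule ℤ (Pr → G) :=
  (Submodule.map (dvL G K) (Ngr G K p (q - 1)) ⊔
    Submodule.map (dhL G K) (Ngr G K (p + 1) q ⊓ LinearMap.ker (dvL G K))) ⊓ Ngr G K p q

/-- The cohomeology group `𝓗^{p,q}(K; G)`: the `E₂`-page of the cohomeology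
spectral sequence in bidegree `(p,q)`. -/
abbrev HH (K : SC) (p q : ℤ) :=
  ↥(Z2 G K p q) ⧸ Submodule.comap (Z2 G K p q).subtype (B2 G K p q)

/-- Reduced `E₂`-cocycles. -/
def Z2R (K : SC) (p q : ℤ) : Submodule ℤ (Pr → G) :=
  NgrR G K p q ⊓ LinearMap.ker (dvRL G K) ⊓
    Submodule.comap (dhRL G K) (Submodule.map (dvRL G K) (NgrR G K (p - 1) (q - 1)))

/-- Reduced `E₂`-coboundaries. -/
def B2R (K : SC) (p q : ℤ) : Submodule ℤ (Pr → G) :=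
  (Submodule.map (dvRL G K) (NgrR G K p (q - 1)) ⊔
    Submodule.map (dhRL G K) (NgrR G K (p + 1) q ⊓ LinearMap.ker (dvRL G K))) ⊓ NgrR G K p q

/-- The reduced cohomeology group `𝓗̃^{p,q}(K; G)`. -/
abbrev HHR (K : SC) (p q : ℤ) :=
  ↥(Z2R G K p q) ⧸ Submodule.comap (Z2R G K p q).subtype (B2R G K p q)

/-- Total-degree-`n` part of the total complex of `N^{*,*}(K)`. -/
def Tgr (K : SC) (n : ℤ) : Submodule ℤ (Pr → G) :=
  suppM G fun x => x.1 ⊆ x.2 ∧ x.2 ∈ K.faces ∧ x.1 ≠ ∅ ∧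
    (x.2.card : ℤ) - (x.1.card : ℤ) = n

/-- Total-degree-`n` part of the total complex of `Ñ^{*,*}(K)`. -/
def TgrR (K : SC) (n : ℤ) : Submodule ℤ (Pr → G) :=
  suppM G fun x => x.1 ⊆ x.2 ∧ x.2 ∈ K.faces ∧
    (x.2.card : ℤ) - (x.1.card : ℤ) = n

/-- The degree-`n` cohomology of the total complex of `N^{*,*}(K)`. -/
abbrev TotH (K : SC) (n : ℤ) :=
  ↥(Tgr G K n ⊓ LinearMap.ker (dL G K)) ⧸
    Submodule.comap (Tgr G K n ⊓ LinearMap.ker (dL G K)).subtype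
      (Submodule.map (dL G K) (Tgr G K (n - 1)) ⊓ Tgr G K n)

/-- The degree-`n` cohomology of the total complex of `Ñ^{*,*}(K)`. -/
abbrev TotHR (K : SC) (n : ℤ) :=
  ↥(TgrR G K n ⊓ LinearMap.ker (dRL G K)) ⧸
    Submodule.comap (TgrR G K n ⊓ LinearMap.ker (dRL G K)).subtype
      (Submodule.map (dRL G K) (TgrR G K (n - 1)) ⊓ TgrR G K n)

/-- The filtration `F^p` of the total complex by first degree. -/
def Fil (p : ℤ) : Submodule ℤ (Pr → G) :=
  suppM G fun x => (x.1.card : ℤ) ≤ p + 1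

/-- The `E_∞`-term of the cohomeology spectral sequence in bidegree `(p,p)`:
the `p`-th graded piece of the filtration induced on `H^0` of the total complex. -/
abbrev Einf0 (K : SC) (p : ℤ) :=
  ↥(Tgr ℤ K 0 ⊓ LinearMap.ker (dL ℤ K) ⊓ Fil ℤ p) ⧸
    Submodule.comap (Tgr ℤ K 0 ⊓ LinearMap.ker (dL ℤ K) ⊓ Fil ℤ p).subtype
      ((Tgr ℤ K 0 ⊓ LinearMap.ker (dL ℤ K) ⊓ Fil ℤ (p - 1)) ⊔
        (Submodule.map (dL ℤ K) (Tgr ℤ K (-1)) ⊓ Tgr ℤ K 0 ⊓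
          LinearMap.ker (dL ℤ K) ⊓ Fil ℤ p))

end SC
namespace SC
open Finset

theorem sum_sum_erase_eq_zero {s : Finset ℕ} {f : ℕ → ℕ → ℤ}
    (hf : ∀ v ∈ s, ∀ w ∈ s, v ≠ w → f v w = -f w v) :
    ∑ v ∈ s, ∑ w ∈ s.erase v, f v w = 0 := by
  have hswap : ∑ v ∈ s, ∑ w ∈ s.erase v, f v w = -∑ v ∈ s, ∑ w ∈ s.erase v, f v w := by
    calc ∑ v ∈ s, ∑ w ∈ s.erase v, f v w = ∑ v ∈ s, ∑ w ∈ s.erase v, -f w v := by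
          refine sum_congr rfl fun v hv => sum_congr rfl fun w hw => ?_
          exact hf v hv w (mem_of_mem_erase hw) (ne_of_mem_erase hw).symm
      _ = ∑ w ∈ s, ∑ v ∈ s.erase w, -f w v := by
          refine sum_comm' fun v w => ?_
          simp only [mem_erase]
          tauto
      _ = -∑ v ∈ s, ∑ w ∈ s.erase v, f v w := by simp only [sum_neg_distrib]
  linarith

theorem psgn_insert_self (v : ℕ) (s : Finset ℕ) : psgn v (insert v s) = psgn v s := by
  simp [psgn, filter_insert]

theorem psgn_insert_of_lt {v w : ℕ} {s : Finset ℕ} (h : w < v) (hw : w ∉ s) :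
    psgn v (insert w s) = -psgn v s := by
  simp [psgn, filter_insert, h, hw, pow_succ]

theorem psgn_insert_of_gt {v w : ℕ} {s : Finset ℕ} (h : v < w) :
    psgn v (insert w s) = psgn v s := by
  simp [psgn, filter_insert, h.not_gt]

theorem psgn_erase_self (v : ℕ) (s : Finset ℕ) : psgn v (s.erase v) = psgn v s := by
  by_cases hv : v ∈ s
  · conv_rhs => rw [← insert_erase hv]
    rw [psgn_insert_self]
  · rw [erase_eq_of_notMem hv]

theorem psgn_mul_self (v : ℕ) (s : Finset ℕ) : psgn v s * psgn v s = 1 := by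
  rw [psgn, ← mul_pow]
  simp

theorem psgn_insert_mul_anticomm {v w : ℕ} {s : Finset ℕ} (hvw : v ≠ w) (hv : v ∉ s)
    (hw : w ∉ s) :
    psgn v s * psgn w (insert v s) = -(psgn w s * psgn v (insert w s)) := by
  rcases lt_or_gt_of_ne hvw with h | h
  · rw [psgn_insert_of_lt h hv, psgn_insert_of_gt h]
    ring
  · rw [psgn_insert_of_lt h hw, psgn_insert_of_gt h]
    ring

theorem psgn_erase_mul_anticomm {v w : ℕ} {s : Finset ℕ} (hvw : v ≠ w) (hv : v ∈ s)
    (hw : w ∈ s) :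
    psgn v s * psgn w (s.erase v) = -(psgn w s * psgn v (s.erase w)) := by
  have h := psgn_insert_mul_anticomm (s := (s.erase v).erase w) hvw (by simp) (by simp)
  have hvs : insert v ((s.erase v).erase w) = s.erase w := by
    rw [erase_right_comm, insert_erase (by simp [hvw, hv])]
  have hvu : psgn v ((s.erase v).erase w) = psgn v (s.erase w) := by
    rw [erase_right_comm, psgn_erase_self]
  have hws : insert w ((s.erase v).erase w) = s.erase v :=
    insert_erase (by simp [hvw.symm, hw])
  rw [hvs, hws, hvu] at h
  simp only [psgn_erase_self] at h
  linarith

theorem dhRF_apply {K : SC} {σ τ : Finset ℕ} (hτ : τ ∈ K.faces) (hστ : σ ⊆ τ) (c : Pr → ℤ) :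
    dhRF ℤ K c (σ, τ) = ∑ v ∈ τ \ σ, psgn v σ * c (insert v σ, τ) := by
  simp [dhRF, hτ, hστ, psgn_insert_self]

theorem dvRF_apply {K : SC} {σ τ : Finset ℕ} (hτ : τ ∈ K.faces) (hστ : σ ⊆ τ) (c : Pr → ℤ) :
    dvRF ℤ K c (σ, τ) =
      (-1) ^ σ.card * ∑ w ∈ τ \ σ, psgn w τ * c (σ, τ.erase w) := by
  have hfilter : τ.filter (fun w => σ ⊆ τ.erase w) = τ \ σ := by
    ext w
    simp [subset_erase, hστ]
  simp [dvRF, hτ, hστ, ← sum_filter, hfilter]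

theorem dRL_apply {K : SC} {σ τ : Finset ℕ} (hτ : τ ∈ K.faces) (hστ : σ ⊆ τ) (c : Pr → ℤ) :
    dRL ℤ K c (σ, τ) = ∑ v ∈ τ \ σ, psgn v σ * c (insert v σ, τ) +
      (-1) ^ σ.card * ∑ w ∈ τ \ σ, psgn w τ * c (σ, τ.erase w) := by
  rw [← dhRF_apply hτ hστ, ← dvRF_apply hτ hστ]
  rfl

theorem dRL_apply_of_not {K : SC} {x : Pr} (hx : ¬(x.2 ∈ K.faces ∧ x.1 ⊆ x.2)) (c : Pr → ℤ) :
    dRL ℤ K c x = 0 := by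
  change dhRF ℤ K c x + dvRF ℤ K c x = 0
  simp [dhRF, dvRF, hx]

theorem dhRF_dhRF (K : SC) (c : Pr → ℤ) : dhRF ℤ K (dhRF ℤ K c) = 0 := by
  funext ⟨σ, τ⟩
  by_cases hx : τ ∈ K.faces ∧ σ ⊆ τ
  · obtain ⟨hτ, hστ⟩ := hx
    rw [dhRF_apply hτ hστ]
    trans ∑ v ∈ τ \ σ, ∑ w ∈ (τ \ σ).erase v,
      psgn v σ * psgn w (insert v σ) * c (insert w (insert v σ), τ)
    · refine sum_congr rfl fun v hv => ?_
      rw [dhRF_apply hτ (insert_subset (mem_sdiff.mp hv).1 hστ), mul_sum, sdiff_insert]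
      simp only [mul_assoc]
    · refine sum_sum_erase_eq_zero fun v hv w hw hvw => ?_
      rw [psgn_insert_mul_anticomm hvw (mem_sdiff.mp hv).2 (mem_sdiff.mp hw).2, neg_mul,
        insert_comm]
  · simp [dhRF, hx]

theorem dvRF_dvRF (K : SC) (c : Pr → ℤ) : dvRF ℤ K (dvRF ℤ K c) = 0 := by
  funext ⟨σ, τ⟩
  by_cases hx : τ ∈ K.faces ∧ σ ⊆ τ
  · obtain ⟨hτ, hστ⟩ := hx
    rw [dvRF_apply hτ hστ, Pi.zero_apply, mul_eq_zero]
    right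
    trans ∑ v ∈ τ \ σ, ∑ w ∈ (τ \ σ).erase v,
      psgn v τ * psgn w (τ.erase v) * ((-1) ^ σ.card * c (σ, (τ.erase v).erase w))
    · refine sum_congr rfl fun v hv => ?_
      rw [dvRF_apply (K.down_closed hτ (erase_subset _ _))
        (subset_erase.mpr ⟨hστ, (mem_sdiff.mp hv).2⟩), mul_sum, mul_sum, erase_sdiff_comm]
      exact sum_congr rfl fun w _ => by ring
    · refine sum_sum_erase_eq_zero fun v hv w hw hvw => ?_
      rw [psgn_erase_mul_anticomm hvw (mem_sdiff.mp hv).1 (mem_sdiff.mp hw).1, neg_mul,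
        erase_right_comm]
  · simp [dvRF, hx]

theorem dhRF_dvRF_add_dvRF_dhRF (K : SC) (c : Pr → ℤ) :
    dhRF ℤ K (dvRF ℤ K c) + dvRF ℤ K (dhRF ℤ K c) = 0 := by
  funext ⟨σ, τ⟩
  by_cases hx : τ ∈ K.faces ∧ σ ⊆ τ
  · obtain ⟨hτ, hστ⟩ := hx
    rw [Pi.add_apply, dhRF_apply hτ hστ, dvRF_apply hτ hστ, Pi.zero_apply,
      ← eq_neg_iff_add_eq_zero]
    trans ∑ v ∈ τ \ σ, ∑ w ∈ (τ \ σ).erase v,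
      -((-1) ^ σ.card * psgn v σ * psgn w τ * c (insert v σ, τ.erase w))
    · refine sum_congr rfl fun v hv => ?_
      rw [dvRF_apply hτ (insert_subset (mem_sdiff.mp hv).1 hστ), mul_sum, mul_sum,
        sdiff_insert, card_insert_of_notMem (mem_sdiff.mp hv).2]
      exact sum_congr rfl fun w _ => by ring
    · rw [mul_sum, ← sum_neg_distrib, sum_comm' (t' := τ \ σ) (s' := fun w => (τ \ σ).erase w)
        (fun v w => by simp only [mem_erase]; tauto)]
      refine sum_congr rfl fun w hw => ?_
      rw [dhRF_apply (K.down_closed hτ (erase_subset _ _))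
        (subset_erase.mpr ⟨hστ, (mem_sdiff.mp hw).2⟩), mul_sum, mul_sum, erase_sdiff_comm,
        ← sum_neg_distrib]
      exact sum_congr rfl fun v _ => by ring
  · simp [dvRF, dhRF, hx]

theorem dRL_dRL (K : SC) (c : Pr → ℤ) : dRL ℤ K (dRL ℤ K c) = 0 := by
  have hh : dhRL ℤ K (dhRL ℤ K c) = 0 := dhRF_dhRF K c
  have hv : dvRL ℤ K (dvRL ℤ K c) = 0 := dvRF_dvRF K c
  have hhv : dhRL ℤ K (dvRL ℤ K c) + dvRL ℤ K (dhRL ℤ K c) = 0 :=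
    dhRF_dvRF_add_dvRF_dhRF K c
  simp only [dRL, LinearMap.add_apply, map_add, hh, hv, zero_add, add_zero]
  rw [add_comm, hhv]

theorem dRL_mem_TgrR {K : SC} {n : ℤ} {c : Pr → ℤ} (hc : c ∈ TgrR ℤ K n) :
    dRL ℤ K c ∈ TgrR ℤ K (n + 1) := by
  rintro ⟨σ, τ⟩ hne
  by_cases hx : τ ∈ K.faces ∧ σ ⊆ τ
  swap
  · exact absurd (dRL_apply_of_not hx c) hne
  obtain ⟨hτ, hστ⟩ := hx
  refine ⟨hστ, hτ, ?_⟩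
  by_contra hn
  refine hne ?_
  have hzero : ∀ x : Pr, (x.2.card : ℤ) - x.1.card ≠ n → c x = 0 := fun x hx => by
    by_contra h
    exact hx (hc x h).2.2
  rw [dRL_apply hτ hστ, sum_eq_zero, sum_eq_zero]
  · simp
  · intro w hw
    rw [hzero, mul_zero]
    have := card_erase_add_one (mem_sdiff.mp hw).1
    simp only at hn ⊢
    omega
  · intro v hv
    rw [hzero, mul_zero]
    have := card_insert_of_notMem (mem_sdiff.mp hv).2
    simp only at hn ⊢
    omega

/-- Coning off the smallest vertex of `τ` in the factor `σ` of `σ ⊗ τ`. -/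
def coneF (c : Pr → ℤ) : Pr → ℤ := fun x =>
  if hx : x.2.Nonempty then
    if x.2.min' hx ∈ x.1 then c (x.1.erase (x.2.min' hx), x.2) else 0
  else 0

theorem psgn_min' {σ τ : Finset ℕ} (hτ : τ.Nonempty) (hστ : σ ⊆ τ) :
    psgn (τ.min' hτ) σ = 1 := by
  rw [psgn, filter_eq_empty_iff.mpr, card_empty, pow_zero]
  exact fun u hu => (τ.min'_le u (hστ hu)).not_gt

theorem dhRF_coneF_add_coneF_dhRF {K : SC} {σ τ : Finset ℕ} (hτ : τ ∈ K.faces) (hστ : σ ⊆ τ)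
    (hne : τ.Nonempty) (c : Pr → ℤ) :
    dhRF ℤ K (coneF c) (σ, τ) + coneF (dhRF ℤ K c) (σ, τ) = c (σ, τ) := by
  set m := τ.min' hne with hm
  have hmτ : m ∈ τ := τ.min'_mem hne
  have hcone : ∀ (b : Pr → ℤ) (ρ : Finset ℕ),
      coneF b (ρ, τ) = if m ∈ ρ then b (ρ.erase m, τ) else 0 := fun b ρ => by
    simp [coneF, hne, hm]
  rw [dhRF_apply hτ hστ, hcone]
  simp only [hcone]
  by_cases hmσ : m ∈ σ
  · have hsub : σ.erase m ⊆ τ := (erase_subset _ _).trans hστ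
    have hsdiff : τ \ σ.erase m = insert m (τ \ σ) := sdiff_erase hmτ
    rw [if_pos hmσ, dhRF_apply hτ hsub, hsdiff, sum_insert (by simp [hmσ]),
      psgn_min' hne hsub, insert_erase hmσ, one_mul, add_left_comm, ← sum_add_distrib,
      sum_eq_zero, add_zero]
    intro v hv
    obtain ⟨hvτ, hvσ⟩ := mem_sdiff.mp hv
    have hmv : m ≠ v := fun h => hvσ (h ▸ hmσ)
    have hlt : m < v := lt_of_le_of_ne (τ.min'_le v hvτ) hmv
    have hs : psgn v σ = -psgn v (σ.erase m) := by
      rw [← psgn_insert_of_lt hlt (notMem_erase m σ), insert_erase hmσ]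
    rw [if_pos (mem_insert_of_mem hmσ), erase_insert_of_ne hmv.symm, hs]
    ring
  · rw [if_neg hmσ, add_zero, sum_eq_single_of_mem m (mem_sdiff.mpr ⟨hmτ, hmσ⟩)]
    · rw [if_pos (mem_insert_self _ _), erase_insert hmσ, psgn_min' hne hστ, one_mul]
    · intro v _ hv
      rw [if_neg (by simp [hmσ, hv.symm]), mul_zero]

theorem coneF_mem_TgrR {K : SC} {n : ℤ} {c : Pr → ℤ} (hc : c ∈ TgrR ℤ K n) :
    coneF c ∈ TgrR ℤ K (n - 1) := by
  rintro ⟨σ, τ⟩ hx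
  simp only [coneF] at hx
  split_ifs at hx with hne hm
  · obtain ⟨hsub, hτ, hn⟩ := hc _ hx
    have hcard := card_erase_add_one hm
    refine ⟨?_, hτ, ?_⟩
    · rw [← insert_erase hm]
      exact insert_subset (τ.min'_mem hne) hsub
    · simp only at hn ⊢
      omega
  all_goals exact absurd rfl hx

/-- If a cocycle of nonzero total degree vanishes on all `σ ⊗ τ` with `|τ| < k`, then subtracting
the coboundary of its cone makes it vanish on all `σ ⊗ τ` with `|τ| ≤ k`. -/
theorem sub_dRL_coneF_eq_zero {K : SC} {n : ℤ} (hn : n ≠ 0) {c : Pr → ℤ}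
    (hc : c ∈ TgrR ℤ K n) (hdc : dRL ℤ K c = 0) {k : ℕ}
    (hk : ∀ x : Pr, x.2.card < k → c x = 0) (x : Pr) (hx : x.2.card < k + 1) :
    (c - dRL ℤ K (coneF c)) x = 0 := by
  obtain ⟨σ, τ⟩ := x
  by_cases hστ : τ ∈ K.faces ∧ σ ⊆ τ
  swap
  · have hzero : c (σ, τ) = 0 := by
      by_contra h
      exact hστ ⟨(hc _ h).2.1, (hc _ h).1⟩
    rw [Pi.sub_apply, dRL_apply_of_not hστ, hzero, sub_zero]
  obtain ⟨hτ, hστ⟩ := hστ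
  have hdv : ∀ (b : Pr → ℤ), (∀ x : Pr, x.2.card < k → b x = 0) → ∀ ρ ⊆ τ,
      dvRF ℤ K b (ρ, τ) = 0 := by
    intro b hb ρ hρ
    rw [dvRF_apply hτ hρ, sum_eq_zero, mul_zero]
    intro w hw
    rw [hb, mul_zero]
    have := card_erase_add_one (mem_sdiff.mp hw).1
    simp only at hx ⊢
    omega
  have hd : ∀ (b : Pr → ℤ) (x : Pr), dRL ℤ K b x = dhRF ℤ K b x + dvRF ℤ K b x :=
    fun _ _ => rfl
  have hcone : ∀ x : Pr, x.2.card < k → coneF c x = 0 := fun x hx => by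
    simp only [coneF]
    split_ifs
    exacts [hk _ hx, rfl, rfl]
  rw [Pi.sub_apply, hd, hdv _ hcone σ hστ, add_zero]
  rcases τ.eq_empty_or_nonempty with rfl | hne
  · obtain rfl := subset_empty.mp hστ
    have hzero : c (∅, ∅) = 0 := by
      by_contra h
      exact hn (by simpa using (hc _ h).2.2.symm)
    simp [dhRF, hzero]
  · have hhom := dhRF_coneF_add_coneF_dhRF hτ hστ hne c
    have hdh : ∀ ρ ⊆ τ, dhRF ℤ K c (ρ, τ) = 0 := fun ρ hρ => by
      have h0 := hd c (ρ, τ)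
      rw [hdc, hdv c hk ρ hρ, add_zero] at h0
      exact h0.symm
    have hcdh : coneF (dhRF ℤ K c) (σ, τ) = 0 := by
      simp only [coneF]
      split_ifs
      exacts [hdh _ ((erase_subset _ _).trans hστ), rfl]
    rw [hcdh, add_zero] at hhom
    rw [hhom, sub_self]

theorem exists_dRL_eq {K : SC} {n : ℤ} (hn : n ≠ 0) {c : Pr → ℤ}
    (hc : c ∈ TgrR ℤ K n) (hdc : dRL ℤ K c = 0) :
    ∃ b ∈ TgrR ℤ K (n - 1), dRL ℤ K b = c := by
  suffices H : ∀ j k : ℕ, K.faces.sup card < k + j → ∀ c ∈ TgrR ℤ K n, dRL ℤ K c = 0 →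
      (∀ x : Pr, x.2.card < k → c x = 0) → ∃ b ∈ TgrR ℤ K (n - 1), dRL ℤ K b = c from
    H (K.faces.sup card + 1) 0 (by omega) c hc hdc (by simp)
  intro j
  induction j with
  | zero =>
    intro k hK c hc _ hk
    refine ⟨0, zero_mem _, ?_⟩
    rw [map_zero]
    funext x
    by_contra hx
    have hcx : c x ≠ 0 := fun h => hx h.symm
    exact hcx (hk x ((le_sup (f := card) (hc x hcx).2.1).trans_lt hK))
  | succ j ih =>
    intro k hK c hc hdc hk
    have hmem : dRL ℤ K (coneF c) ∈ TgrR ℤ K n := by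
      simpa using dRL_mem_TgrR (coneF_mem_TgrR hc)
    obtain ⟨b, hb, hdb⟩ := ih (k + 1) (by omega) (c - dRL ℤ K (coneF c)) (sub_mem hc hmem)
      (by rw [map_sub, hdc, dRL_dRL, sub_zero]) (sub_dRL_coneF_eq_zero hn hc hdc hk)
    exact ⟨b + coneF c, add_mem hb (coneF_mem_TgrR hc), by rw [map_add, hdb, sub_add_cancel]⟩

theorem TgrR_eq_bot_of_neg {K : SC} {n : ℤ} (hn : n < 0) : TgrR ℤ K n = ⊥ := by
  refine (Submodule.eq_bot_iff _).mpr fun c hc => funext fun x => ?_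
  by_contra hx
  obtain ⟨hsub, -, hcard⟩ := hc x hx
  have := card_le_card hsub
  omega

/-- The sign `(-1) ^ (1 + 2 + ⋯ + k)`. -/
def diagSign (k : ℕ) : ℤ := ∏ i ∈ range k, (-1) ^ (i + 1)

/-- The cochain `∑ ± z • σ ⊗ σ` on the diagonal. -/
def diagCochain (K : SC) (z : ℤ) : Pr → ℤ := fun x =>
  if x.2 ∈ K.faces ∧ x.1 = x.2 then diagSign x.2.card * z else 0

theorem diagCochain_mem_TgrR (K : SC) (z : ℤ) : diagCochain K z ∈ TgrR ℤ K 0 := by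
  intro x hx
  simp only [diagCochain] at hx
  split_ifs at hx with h
  · exact ⟨h.2.le, h.1, by rw [h.2, sub_self]⟩
  · exact absurd rfl hx

/-- Writing an element of degree one as `σ ⊗ (σ ∪ v)`, the differential of a cochain of
degree zero has a single term of each kind. -/
theorem dRL_apply_insert {K : SC} {σ : Finset ℕ} {v : ℕ} (hv : v ∉ σ)
    (hτ : insert v σ ∈ K.faces) (c : Pr → ℤ) :
    dRL ℤ K c (σ, insert v σ) =
      psgn v σ * (c (insert v σ, insert v σ) + (-1) ^ σ.card * c (σ, σ)) := by
  have hsdiff : insert v σ \ σ = {v} := by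
    rw [insert_sdiff_of_notMem _ hv, sdiff_self]
    rfl
  rw [dRL_apply hτ (subset_insert _ _), hsdiff, sum_singleton, sum_singleton, erase_insert hv,
    psgn_insert_self]
  ring

theorem dRL_diagCochain (K : SC) (z : ℤ) : dRL ℤ K (diagCochain K z) = 0 := by
  funext ⟨σ, τ⟩
  by_contra hne
  obtain ⟨hστ, hτ, hcard⟩ := dRL_mem_TgrR (diagCochain_mem_TgrR K z) _ hne
  obtain ⟨v, hv, rfl⟩ : ∃ v, v ∉ σ ∧ insert v σ = τ := by
    refine exists_eq_insert_iff.mpr ⟨hστ, ?_⟩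
    simp only at hcard
    omega
  refine hne ?_
  rw [dRL_apply_insert hv hτ]
  have hσ : σ ∈ K.faces := K.down_closed hτ (subset_insert _ _)
  simp only [diagCochain, hτ, hσ, and_self, if_true, card_insert_of_notMem hv, diagSign,
    prod_range_succ, Pi.zero_apply]
  ring

theorem eq_zero_of_dRL_eq_zero {K : SC} {c : Pr → ℤ} (hc : c ∈ TgrR ℤ K 0)
    (hdc : dRL ℤ K c = 0) (h0 : c (∅, ∅) = 0) : c = 0 := by
  have hdiag : ∀ σ : Finset ℕ, σ ∈ K.faces → c (σ, σ) = 0 := by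
    intro σ
    induction σ using Finset.induction_on with
    | empty => exact fun _ => h0
    | insert v σ hv ih =>
      intro hτ
      have hd := dRL_apply_insert hv hτ c
      rw [hdc, ih (K.down_closed hτ (subset_insert _ _)), mul_zero, add_zero] at hd
      calc c (insert v σ, insert v σ)
          = psgn v σ * psgn v σ * c (insert v σ, insert v σ) := by rw [psgn_mul_self, one_mul]
        _ = 0 := by rw [mul_assoc, ← hd, Pi.zero_apply, mul_zero]
  funext ⟨σ, τ⟩
  by_contra hne
  obtain ⟨hστ, hτ, hcard⟩ := hc _ hne
  obtain rfl : σ = τ := eq_of_subset_of_card_le hστ (by simp only at hcard; omega)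
  exact hne (hdiag σ hτ)

/-- Cocycles of total degree zero are determined by their value at `∅ ⊗ ∅`. -/
noncomputable def cocyclesZeroEquiv (K : SC) (h : ∅ ∈ K.faces) :
    ↥(TgrR ℤ K 0 ⊓ LinearMap.ker (dRL ℤ K)) ≃ₗ[ℤ] ℤ :=
  LinearEquiv.ofBijective
    (LinearMap.proj ((∅, ∅) : Pr) ∘ₗ (TgrR ℤ K 0 ⊓ LinearMap.ker (dRL ℤ K)).subtype) <| by
    constructor
    · refine (injective_iff_map_eq_zero _).mpr fun c hc => Subtype.ext ?_
      exact eq_zero_of_dRL_eq_zero c.2.1 c.2.2 hc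
    · intro z
      refine ⟨⟨diagCochain K z, diagCochain_mem_TgrR K z, dRL_diagCochain K z⟩, ?_⟩
      simp [diagCochain, diagSign, h]

end SC

/-- The cohomology of the total complex of the reduced double
complex `Ñ^{*,*}(K)` is `ℤ`, concentrated in total degree `0`. -/
theorem totHR_iso_int (K : SC) (h : ∅ ∈ K.faces) :
    Nonempty (SC.TotHR ℤ K 0 ≃+ ℤ) ∧
    ∀ n : ℤ, n ≠ 0 → Subsingleton (SC.TotHR ℤ K n) := by
  constructor
  · have hbot : Submodule.comap (SC.TgrR ℤ K 0 ⊓ LinearMap.ker (SC.dRL ℤ K)).subtype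
        (Submodule.map (SC.dRL ℤ K) (SC.TgrR ℤ K (0 - 1)) ⊓ SC.TgrR ℤ K 0) = ⊥ := by
      rw [SC.TgrR_eq_bot_of_neg (by norm_num : (0 - 1 : ℤ) < 0), Submodule.map_bot, bot_inf_eq,
        Submodule.comap_bot, Submodule.ker_subtype]
    exact ⟨((Submodule.quotEquivOfEqBot _ hbot).trans
      (SC.cocyclesZeroEquiv K h)).toAddEquiv⟩
  · intro n hn
    refine Submodule.Quotient.subsingleton_iff.mpr (eq_top_iff.mpr fun c _ => ?_)
    exact ⟨SC.exists_dRL_eq hn c.2.1 c.2.2, c.2.1⟩
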